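/- Let K and E be n×n Hermitian complex matrices. Then trace( (I + iK)⁻¹ · (iE) ) = trace( K(I + K²)⁻¹E ) + i · trace( (I + K²)⁻¹E ), and both trace( K(I + K²)⁻¹E ) and trace( (I + K²)⁻¹E ) are real numbers (their imaginary parts vanish). -/

import Mathlib

namespace Matrix

variable {m : Type*} [Fintype m]

theorem IsHermitian.im_trace_mul_eq_zero {A B : Matrix m m ℂ}
    (hA : A.IsHermitian) (hB : B.IsHermitian) : (A * B).trace.im = 0 := by
  rw [← Complex.conj_eq_iff_im, starRingEnd_apply, ← trace_conjTranspose, conjTranspose_mul,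
    hA.eq, hB.eq, trace_mul_comm]

variable [DecidableEq m]

theorem IsHermitian.isUnit_one_add_sq {K : Matrix m m ℂ} (hK : K.IsHermitian) :
    IsUnit (1 + K ^ 2) := by
  open scoped ComplexOrder in
  have h : (Kᴴ * K).PosSemidef := posSemidef_conjTranspose_mul_self K
  rw [hK.eq, ← sq] at h
  exact (PosDef.one.add_posSemidef h).isUnit

theorem IsHermitian.inv_one_add_I_smul {K : Matrix m m ℂ} (hK : K.IsHermitian) :
    (1 + Complex.I • K)⁻¹ = (1 - Complex.I • K) * (1 + K ^ 2)⁻¹ := by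
  apply inv_eq_right_inv
  have h : (1 + Complex.I • K) * (1 - Complex.I • K) = 1 + K ^ 2 := by
    simp [add_mul, mul_sub, smul_smul, sq]
    abel
  rw [← mul_assoc, h, mul_nonsing_inv _ ((isUnit_iff_isUnit_det _).1 hK.isUnit_one_add_sq)]

theorem IsHermitian.inv_one_add_sq {K : Matrix m m ℂ} (hK : K.IsHermitian) :
    (1 + K ^ 2)⁻¹.IsHermitian :=
  (isHermitian_one.add (hK.pow 2)).inv

theorem IsHermitian.mul_inv_one_add_sq {K : Matrix m m ℂ} (hK : K.IsHermitian) :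
    (K * (1 + K ^ 2)⁻¹).IsHermitian := by
  have hdet := (isUnit_iff_isUnit_det _).1 hK.isUnit_one_add_sq
  have hcomm : K * (1 + K ^ 2) = (1 + K ^ 2) * K := by noncomm_ring
  rw [IsHermitian, conjTranspose_mul, hK.inv_one_add_sq.eq, hK.eq]
  calc (1 + K ^ 2)⁻¹ * K = (1 + K ^ 2)⁻¹ * (K * (1 + K ^ 2)) * (1 + K ^ 2)⁻¹ := by
        rw [← mul_assoc, mul_nonsing_inv_cancel_right _ _ hdet]
    _ = K * (1 + K ^ 2)⁻¹ := by
        rw [hcomm, nonsing_inv_mul_cancel_left _ _ hdet]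

end Matrix

theorem stmt_7 (n : ℕ) (K E : Matrix (Fin n) (Fin n) ℂ)
    (hK : K.IsHermitian) (hE : E.IsHermitian) :
    ((1 + Complex.I • K)⁻¹ * (Complex.I • E)).trace =
        (K * (1 + K ^ 2)⁻¹ * E).trace + Complex.I * ((1 + K ^ 2)⁻¹ * E).trace ∧
    ((K * (1 + K ^ 2)⁻¹ * E).trace).im = 0 ∧
    (((1 + K ^ 2)⁻¹ * E).trace).im = 0 := by
  refine ⟨?_, hK.mul_inv_one_add_sq.im_trace_mul_eq_zero hE,
    hK.inv_one_add_sq.im_trace_mul_eq_zero hE⟩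
  rw [hK.inv_one_add_I_smul, ← smul_eq_mul Complex.I, ← Matrix.trace_smul, ← Matrix.trace_add]
  congr 1
  simp [sub_mul, smul_sub, smul_smul, add_comm]
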